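/- arXiv:1312.0296 — 3 statements merged into one kernel-verified Lean document; each statement's English description precedes it below -/
import Mathlib

section
/- For every prime p and integers n ≥ 1 and 1 ≤ k ≤ n−1, the number of subgroups of order p^k of the elementary abelian group (ℤ/pℤ)^n equals a_{n,p}(k) = ∑_{1≤i₁<i₂<⋯<i_k≤n} p^{i₁+i₂+⋯+i_k − k(k+1)/2}. -/
open Finset Pointwise

/-- `a_{n,p}(k)` as the explicit sum `∑_{1≤i₁<⋯<i_k≤n} p^{i₁+⋯+i_k - k(k+1)/2}` over
increasing index tuples, encoded as `k`-element subsets of `{1, …, n}`. -/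
def aFormula (p n k : ℕ) : ℕ :=
  ∑ s ∈ (Finset.Icc 1 n).powersetCard k, p ^ ((∑ i ∈ s, i) - k * (k + 1) / 2)

/-- `a_{n,p}(k)`: `1` if `k = 0` or `k = n`, and the explicit sum otherwise. -/
def aNPK (p n k : ℕ) : ℕ := if k = 0 ∨ k = n then 1 else aFormula p n k

/-- `a_{n,p} = ∑_{k=0}^n a_{n,p}(k)`. -/
def aNP (p n : ℕ) : ℕ := ∑ k ∈ Finset.range (n + 1), aNPK p n k

/-- A finite set of `k` positive integers has sum at least `1 + 2 + ⋯ + k`. -/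
theorem card_mul_card_succ_div_two_le_sum (s : Finset ℕ) (hs : ∀ i ∈ s, 1 ≤ i) :
    #s * (#s + 1) / 2 ≤ ∑ i ∈ s, i := by
  suffices h : #s * (#s + 1) ≤ 2 * ∑ i ∈ s, i by omega
  induction s using Finset.induction_on_max with
  | empty => simp
  | insert a s hmax ih =>
    have ha : a ∉ s := fun h => lt_irrefl a (hmax a h)
    have hsub : s ⊆ Finset.Ico 1 a := fun x hx =>
      Finset.mem_Ico.2 ⟨hs x (Finset.mem_insert_of_mem hx), hmax x hx⟩
    have hcard := Finset.card_le_card hsub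
    have hpos := hs a (Finset.mem_insert_self a s)
    rw [Nat.card_Ico] at hcard
    have ih := ih fun i hi => hs i (Finset.mem_insert_of_mem hi)
    rw [Finset.card_insert_of_notMem ha, Finset.sum_insert ha]
    have : #s + 1 ≤ a := by omega
    nlinarith

theorem triangular_succ (k : ℕ) : (k + 1) * (k + 1 + 1) / 2 = k * (k + 1) / 2 + (k + 1) := by
  rw [show (k + 1) * (k + 1 + 1) = k * (k + 1) + (k + 1) * 2 by ring,
    Nat.add_mul_div_right _ _ two_pos]

section GaussSum

variable {R : Type*} [CommRing R]

theorem sum_powersetCard_Icc_succ (q : R) (n k : ℕ) :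
    ∑ s ∈ (Finset.Icc 1 (n + 1)).powersetCard (k + 1), q ^ (∑ i ∈ s, i) =
      ∑ s ∈ (Finset.Icc 1 n).powersetCard (k + 1), q ^ (∑ i ∈ s, i) +
        q ^ (n + 1) * ∑ s ∈ (Finset.Icc 1 n).powersetCard k, q ^ (∑ i ∈ s, i) := by
  have hn : n + 1 ∉ Finset.Icc 1 n := by simp
  have hmem : ∀ j, ∀ s ∈ (Finset.Icc 1 n).powersetCard j, n + 1 ∉ s := fun j s hs h =>
    hn ((Finset.mem_powersetCard.1 hs).1 h)
  rw [← Finset.insert_Icc_right_eq_Icc_add_one (by omega : 1 ≤ n + 1),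
    Finset.powersetCard_succ_insert hn, Finset.sum_union, Finset.sum_image, Finset.mul_sum]
  · congr 1
    refine Finset.sum_congr rfl fun s hs => ?_
    rw [Finset.sum_insert (hmem _ s hs), pow_add]
  · intro s hs t ht hst
    rw [← Finset.erase_insert (hmem _ s hs), ← Finset.erase_insert (hmem _ t ht)]
    exact congrArg (fun u => u.erase (n + 1)) hst
  · refine Finset.disjoint_left.2 fun s hs hs' => ?_
    obtain ⟨t, -, rfl⟩ := Finset.mem_image.1 hs'
    exact hmem _ _ hs (Finset.mem_insert_self _ _)

theorem prod_range_succ_pow_sub_pow (q : R) (n k : ℕ) :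
    ∏ i ∈ Finset.range (k + 1), (q ^ (n + 1) - q ^ i) =
      (q ^ (n + 1) - 1) * q ^ k * ∏ i ∈ Finset.range k, (q ^ n - q ^ i) := by
  have h : ∀ i, q ^ (n + 1) - q ^ (i + 1) = q * (q ^ n - q ^ i) := fun i => by ring
  rw [Finset.prod_range_succ']
  simp only [h, Finset.prod_mul_distrib, Finset.prod_const, Finset.card_range, pow_zero]
  ring

/-- The explicit sum satisfies the product formula for Gaussian binomial coefficients. -/
theorem sum_powersetCard_mul_prod (q : R) (n k : ℕ) :
    (∑ s ∈ (Finset.Icc 1 n).powersetCard k, q ^ (∑ i ∈ s, i)) *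
        ∏ i ∈ Finset.range k, (q ^ k - q ^ i) =
      q ^ (k * (k + 1) / 2) * ∏ i ∈ Finset.range k, (q ^ n - q ^ i) := by
  induction n generalizing k with
  | zero =>
    cases k with
    | zero => simp
    | succ k =>
      rw [Finset.powersetCard_eq_empty.2 (by simp), Finset.sum_empty, zero_mul,
        Finset.prod_range_succ']
      simp
  | succ n ih =>
    cases k with
    | zero => simp
    | succ k =>
      have h₁ := ih (k + 1)
      have h₂ := ih k
      rw [triangular_succ, Finset.prod_range_succ (fun i => q ^ n - q ^ i)] at h₁
      rw [sum_powersetCard_Icc_succ, add_mul, triangular_succ, h₁,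
        prod_range_succ_pow_sub_pow, prod_range_succ_pow_sub_pow]
      linear_combination q ^ (n + 1) * (q ^ (k + 1) - 1) * q ^ k * h₂

end GaussSum

theorem pow_mul_aFormula (p n k : ℕ) :
    p ^ (k * (k + 1) / 2) * aFormula p n k =
      ∑ s ∈ (Finset.Icc 1 n).powersetCard k, p ^ (∑ i ∈ s, i) := by
  rw [aFormula, Finset.mul_sum]
  refine Finset.sum_congr rfl fun s hs => ?_
  obtain ⟨hsub, rfl⟩ := Finset.mem_powersetCard.1 hs
  rw [← pow_add, Nat.add_sub_cancel' (card_mul_card_succ_div_two_le_sum s fun i hi =>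
    (Finset.mem_Icc.1 (hsub hi)).1)]

theorem aFormula_mul_prod {p n k : ℕ} (hp : 0 < p) (hk : k ≤ n) :
    aFormula p n k * ∏ i ∈ Finset.range k, (p ^ k - p ^ i) =
      ∏ i ∈ Finset.range k, (p ^ n - p ^ i) := by
  have hcast : ∀ m, k ≤ m → ((∏ i ∈ Finset.range k, (p ^ m - p ^ i) : ℕ) : ℤ) =
      ∏ i ∈ Finset.range k, ((p : ℤ) ^ m - (p : ℤ) ^ i) := fun m hm => by
    rw [Nat.cast_prod]
    refine Finset.prod_congr rfl fun i hi => ?_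
    rw [Nat.cast_sub (Nat.pow_le_pow_right hp ((Finset.mem_range.1 hi).le.trans hm))]
    push_cast
    rfl
  refine Nat.eq_of_mul_eq_mul_left (pow_pos hp (k * (k + 1) / 2)) ?_
  rw [← mul_assoc, pow_mul_aFormula]
  have h := sum_powersetCard_mul_prod (p : ℤ) n k
  rw [← hcast k le_rfl, ← hcast n hk] at h
  exact_mod_cast h

section Subspaces

open Module

variable {K V : Type*} [Field K] [AddCommGroup V] [Module K V]

/-- Linearly independent `k`-tuples with span `W` are linearly independent `k`-tuples in `W`,
when `W` has dimension `k`. -/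
def linearIndependentSpanEquiv [FiniteDimensional K V] {k : ℕ} (W : Submodule K V)
    (hW : finrank K W = k) :
    {s : {s : Fin k → V // LinearIndependent K s} // Submodule.span K (Set.range s.1) = W} ≃
      {s : Fin k → W // LinearIndependent K s} where
  toFun s := ⟨fun i => ⟨s.1.1 i, s.2.le (Submodule.subset_span (Set.mem_range_self i))⟩,
    LinearIndependent.of_comp W.subtype s.1.2⟩
  invFun s := ⟨⟨fun i => s.1 i, s.2.map' W.subtype W.ker_subtype⟩, by
    refine Submodule.eq_of_le_of_finrank_eq (Submodule.span_le.2 ?_) ?_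
    · rintro _ ⟨i, rfl⟩
      exact (s.1 i).2
    · rw [hW]
      exact (finrank_span_eq_card (s.2.map' W.subtype W.ker_subtype)).trans (Fintype.card_fin k)⟩
  left_inv _ := rfl
  right_inv _ := rfl

theorem card_submodule_finrank_mul_prod [Fintype K] [Finite V] {k : ℕ} (hk : k ≤ finrank K V) :
    Nat.card {W : Submodule K V // finrank K W = k} *
        ∏ i ∈ Finset.range k, (Fintype.card K ^ k - Fintype.card K ^ i) =
      ∏ i ∈ Finset.range k, (Fintype.card K ^ finrank K V - Fintype.card K ^ i) := by
  let f : {s : Fin k → V // LinearIndependent K s} → {W : Submodule K V // finrank K W = k} :=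
    fun s => ⟨Submodule.span K (Set.range s.1),
      (finrank_span_eq_card s.2).trans (Fintype.card_fin k)⟩
  have hfiber : ∀ W, Nat.card {s // f s = W} =
      ∏ i ∈ Finset.range k, (Fintype.card K ^ k - Fintype.card K ^ i) := fun W => by
    have e : {s // f s = W} ≃ {s : Fin k → W.1 // LinearIndependent K s} :=
      (Equiv.subtypeEquivRight fun s => Subtype.ext_iff).trans
        (linearIndependentSpanEquiv W.1 W.2)
    rw [Nat.card_congr e, card_linearIndependent W.2.ge, W.2,
      Fin.prod_univ_eq_prod_range (fun i => Fintype.card K ^ k - Fintype.card K ^ i)]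
  have := Fintype.ofFinite {W : Submodule K V // finrank K W = k}
  rw [← Fin.prod_univ_eq_prod_range
      (fun i => Fintype.card K ^ finrank K V - Fintype.card K ^ i),
    ← card_linearIndependent hk, ← Nat.card_congr (Equiv.sigmaFiberEquiv f), Nat.card_sigma]
  simp [hfiber]

end Subspaces

/-- The number of subgroups of order `p^k` of `(ℤ/pℤ)^n` is
`∑_{1≤i₁<⋯<i_k≤n} p^{i₁+⋯+i_k - k(k+1)/2}`, for `1 ≤ k ≤ n - 1`. -/
theorem card_addSubgroups_eq_aFormula (p n k : ℕ) (hp : p.Prime) (hn : 1 ≤ n)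
    (hk1 : 1 ≤ k) (hk2 : k ≤ n - 1) :
    Nat.card {H : AddSubgroup (Fin n → ZMod p) // Nat.card H = p ^ k} = aFormula p n k := by
  have : Fact p.Prime := ⟨hp⟩
  have hkn : k ≤ n := hk2.trans (Nat.sub_le n 1)
  have e : {H : AddSubgroup (Fin n → ZMod p) // Nat.card H = p ^ k} ≃
      {W : Submodule (ZMod p) (Fin n → ZMod p) // Module.finrank (ZMod p) W = k} :=
    (AddSubgroup.toZModSubmodule p).toEquiv.subtypeEquiv fun H => by
      have h := Module.natCard_eq_pow_finrank (K := ZMod p) (V := AddSubgroup.toZModSubmodule p H)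
      rw [Nat.card_zmod] at h
      change Nat.card H = _ at h
      rw [h]
      exact Nat.pow_right_inj hp.two_le
  have hpos : 0 < ∏ i ∈ Finset.range k, (p ^ k - p ^ i) := Finset.prod_pos fun i hi =>
    Nat.sub_pos_of_lt (Nat.pow_lt_pow_right hp.one_lt (Finset.mem_range.1 hi))
  refine Nat.eq_of_mul_eq_mul_right hpos ?_
  rw [aFormula_mul_prod hp.pos hkn, Nat.card_congr e]
  simpa using card_submodule_finrank_mul_prod (K := ZMod p) (V := Fin n → ZMod p) (k := k)
    (by simpa using hkn)
end

section
/- For every prime p and every integer n ≥ 3, the recurrence a_{n,p} = 2·a_{n−1,p} + (p^{n−1} − 1)·a_{n−2,p} holds. -/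
open Finset Pointwise

lemma card_mul_succ_le_two_mul_sum (s : Finset ℕ) (hs : ∀ i ∈ s, 1 ≤ i) :
    #s * (#s + 1) ≤ 2 * ∑ i ∈ s, i := by
  induction s using Finset.induction_on_max with
  | empty => simp
  | insert a s ha ih =>
    have hnot : a ∉ s := fun h => lt_irrefl _ (ha a h)
    have hcard : #s + 1 ≤ a := by
      have hsub : s ⊆ Finset.Ico 1 a := fun i hi =>
        Finset.mem_Ico.2 ⟨hs i (Finset.mem_insert_of_mem hi), ha i hi⟩
      have := Finset.card_le_card hsub
      have := hs a (Finset.mem_insert_self a s)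
      rw [Nat.card_Ico] at *
      omega
    have := ih fun i hi => hs i (Finset.mem_insert_of_mem hi)
    rw [Finset.card_insert_of_notMem hnot, Finset.sum_insert hnot]
    nlinarith

lemma aFormula_zero_right (p n : ℕ) : aFormula p n 0 = 1 := by
  simp [aFormula]

lemma aFormula_eq_zero_of_lt (p : ℕ) {n k : ℕ} (h : n < k) : aFormula p n k = 0 := by
  rw [aFormula, Finset.powersetCard_eq_empty.2 (by simpa using h), Finset.sum_empty]

/-- The `q`-Pascal rule. -/
lemma aFormula_succ_succ (p k m : ℕ) :
    aFormula p (k + m + 1) (k + 1) =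
      aFormula p (k + m) (k + 1) + p ^ m * aFormula p (k + m) k := by
  have hnot : k + m + 1 ∉ Finset.Icc 1 (k + m) := by simp
  have hIcc : Finset.Icc 1 (k + m + 1) = insert (k + m + 1) (Finset.Icc 1 (k + m)) := by
    ext i
    simp only [Finset.mem_insert, Finset.mem_Icc]
    omega
  have hmem {j : ℕ} {s : Finset ℕ} (hs : s ∈ (Finset.Icc 1 (k + m)).powersetCard j) :
      k + m + 1 ∉ s := fun h => hnot ((Finset.mem_powersetCard.1 hs).1 h)
  unfold aFormula
  rw [hIcc, Finset.powersetCard_succ_insert hnot, Finset.sum_union, Finset.sum_image,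
    Finset.mul_sum]
  · congr 1
    refine Finset.sum_congr rfl fun s hs => ?_
    obtain ⟨hsub, hcard⟩ := Finset.mem_powersetCard.1 hs
    have hle := card_mul_succ_le_two_mul_sum s fun i hi => (Finset.mem_Icc.1 (hsub hi)).1
    rw [Finset.sum_insert (hmem hs), ← pow_add]
    congr 1
    rw [hcard] at hle
    have : (k + 1) * (k + 1 + 1) = k * (k + 1) + 2 * (k + 1) := by ring
    omega
  · intro s hs t ht hst
    rw [← Finset.erase_insert (hmem hs), ← Finset.erase_insert (hmem ht), hst]
  · refine Finset.disjoint_left.2 fun s hs hs' => ?_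
    obtain ⟨t, -, rfl⟩ := Finset.mem_image.1 hs'
    exact hmem hs (Finset.mem_insert_self _ _)

lemma aFormula_self (p n : ℕ) : aFormula p n n = 1 := by
  induction n with
  | zero => exact aFormula_zero_right p 0
  | succ n ih =>
    have := aFormula_succ_succ p n 0
    simpa [ih, aFormula_eq_zero_of_lt p (Nat.lt_succ_self n)] using this

lemma aNP_eq_sum_aFormula (p n : ℕ) : aNP p n = ∑ k ∈ Finset.range (n + 1), aFormula p n k := by
  refine Finset.sum_congr rfl fun k _ => ?_
  unfold aNPK
  split_ifs with h
  · rcases h with rfl | rfl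
    · rw [aFormula_zero_right]
    · rw [aFormula_self]
  · rfl

lemma pow_sub_one_mul_aFormula (p k m : ℕ) :
    ((p : ℤ) ^ m - 1) * aFormula p (k + m) k =
      ((p : ℤ) ^ (k + 1) - 1) * aFormula p (k + m) (k + 1) := by
  induction hn : k + m generalizing k m with
  | zero =>
    obtain ⟨rfl, rfl⟩ : k = 0 ∧ m = 0 := by omega
    simp [aFormula_eq_zero_of_lt]
  | succ n ih =>
    rcases m with _ | m
    · simp [aFormula_eq_zero_of_lt p (show n + 1 < k + 1 by omega)]
    obtain rfl : n = k + m := by omega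
    have hk := ih k m rfl
    rcases k with _ | k
    · rw [aFormula_succ_succ]
      simp only [aFormula_zero_right] at hk ⊢
      push_cast
      linear_combination hk
    · have h₁ := ih k (m + 1) (by omega)
      have h₂ := aFormula_succ_succ p k (m + 1)
      rw [show k + (m + 1) = k + 1 + m by omega] at h₂
      rw [h₂, aFormula_succ_succ]
      push_cast
      linear_combination (p : ℤ) ^ (m + 1) * h₁ + hk

lemma pow_sub_one_mul_aFormula_succ (p k m : ℕ) :
    ((p : ℤ) ^ (m + 1) - 1) * aFormula p (k + m + 1) k =
      ((p : ℤ) ^ (k + m + 1) - 1) * aFormula p (k + m) k := by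
  rcases k with _ | k
  · simp [aFormula_zero_right]
  · have h₁ := aFormula_succ_succ p k (m + 1)
    have h₂ := pow_sub_one_mul_aFormula p k (m + 1)
    rw [show k + (m + 1) = k + 1 + m by omega] at h₁ h₂
    rw [h₁]
    push_cast
    linear_combination (p : ℤ) ^ (m + 1) * h₂

lemma aNP_succ (p n : ℕ) :
    aNP p (n + 1) = aNP p n + ∑ k ∈ Finset.range (n + 1), p ^ (n - k) * aFormula p n k := by
  have hpascal : ∀ k ∈ Finset.range (n + 1), aFormula p (n + 1) (k + 1) =
      aFormula p n (k + 1) + p ^ (n - k) * aFormula p n k := by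
    intro k hk
    obtain ⟨m, rfl⟩ := Nat.exists_eq_add_of_le (Nat.lt_succ_iff.1 (Finset.mem_range.1 hk))
    rw [aFormula_succ_succ, Nat.add_sub_cancel_left]
  have hsum : aNP p n = ∑ k ∈ Finset.range (n + 1), aFormula p n (k + 1) + aFormula p n 0 := by
    rw [← Finset.sum_range_succ' (aFormula p n), Finset.sum_range_succ,
      aFormula_eq_zero_of_lt p (Nat.lt_succ_self n), aNP_eq_sum_aFormula, add_zero]
  rw [hsum, aNP_eq_sum_aFormula, Finset.sum_range_succ', Finset.sum_congr rfl hpascal,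
    Finset.sum_add_distrib, aFormula_zero_right, aFormula_zero_right]
  ring

lemma aNP_add_two (p n : ℕ) :
    (aNP p (n + 2) : ℤ) = 2 * aNP p (n + 1) + ((p : ℤ) ^ (n + 1) - 1) * aNP p n := by
  have key : ∑ k ∈ Finset.range (n + 2), (p : ℤ) ^ (n + 1 - k) * aFormula p (n + 1) k =
      aNP p (n + 1) + ((p : ℤ) ^ (n + 1) - 1) * aNP p n := by
    rw [aNP_eq_sum_aFormula, aNP_eq_sum_aFormula, ← sub_eq_iff_eq_add']
    push_cast
    rw [← Finset.sum_sub_distrib, Finset.sum_range_succ, Finset.mul_sum]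
    simp only [Nat.sub_self, pow_zero, one_mul, sub_self, add_zero]
    refine Finset.sum_congr rfl fun k hk => ?_
    obtain ⟨m, rfl⟩ := Nat.exists_eq_add_of_le (Nat.lt_succ_iff.1 (Finset.mem_range.1 hk))
    rw [← pow_sub_one_mul_aFormula_succ, show k + m + 1 - k = m + 1 by omega]
    ring
  rw [aNP_succ]
  push_cast
  rw [key]
  ring

/-- The recurrence `a_{n,p} = 2·a_{n−1,p} + (p^{n−1} − 1)·a_{n−2,p}`. -/
theorem aNP_recurrence (p n : ℕ) (hp : p.Prime) (hn : 3 ≤ n) :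
    aNP p n = 2 * aNP p (n - 1) + (p ^ (n - 1) - 1) * aNP p (n - 2) := by
  obtain ⟨m, rfl⟩ := Nat.exists_eq_add_of_le' (show 2 ≤ n by omega)
  have hpos : 1 ≤ p ^ (m + 1) := Nat.one_le_pow _ _ hp.pos
  rw [show m + 2 - 1 = m + 1 by omega, Nat.add_sub_cancel]
  zify [hpos]
  exact aNP_add_two p m
end

section
/- For every integer n ≥ 1 there exists a polynomial f_n with integer coefficients such that a_{n,p} = f_n(p) for every prime p, the degree of f_n equals ⌊n²/4⌋, and the leading coefficient of f_n is 1 if n is even and 2 if n is odd. -/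
open Finset Pointwise

/-- The Gaussian binomial coefficient `[n choose k]` as an integer polynomial, written as the
generating function of the `k`-element subsets of `{1, …, n}`. -/
noncomputable def gaussPoly (n k : ℕ) : Polynomial ℤ :=
  ∑ s ∈ (Finset.Icc 1 n).powersetCard k, Polynomial.X ^ ((∑ i ∈ s, i) - k * (k + 1) / 2)

lemma card_mul_card_add_one_div_two_le_sum (s : Finset ℕ) (hs : 0 ∉ s) :
    s.card * (s.card + 1) / 2 ≤ ∑ i ∈ s, i := by
  induction s using Finset.induction_on_max with
  | empty => simp
  | insert a s hlt ih =>
    have ha : a ∉ s := fun h => (hlt a h).false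
    have hcard : s.card + 1 ≤ a := by
      have hsub : s ⊆ Finset.Ico 1 a := fun x hx => Finset.mem_Ico.2
        ⟨Nat.one_le_iff_ne_zero.2 fun h => hs (by simp [← h, hx]), hlt x hx⟩
      have hle := Finset.card_le_card hsub
      have ha0 : a ≠ 0 := fun h => hs (by simp [h])
      rw [Nat.card_Ico] at hle
      omega
    have ih' := ih fun h => hs (Finset.mem_insert_of_mem h)
    rw [Finset.card_insert_of_notMem ha, Finset.sum_insert ha]
    have hexp : (s.card + 1) * (s.card + 1 + 1) = s.card * (s.card + 1) + 2 * (s.card + 1) := by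
      ring
    omega

lemma gaussPoly_eq_zero {n k : ℕ} (h : n < k) : gaussPoly n k = 0 := by
  rw [gaussPoly, Finset.powersetCard_eq_empty.2 (by simpa using h), Finset.sum_empty]

lemma gaussPoly_zero_right (n : ℕ) : gaussPoly n 0 = 1 := by
  simp [gaussPoly]

lemma gaussPoly_succ_succ {n k : ℕ} (h : k ≤ n) :
    gaussPoly (n + 1) (k + 1) = gaussPoly n (k + 1) + Polynomial.X ^ (n - k) * gaussPoly n k := by
  have hn : n + 1 ∉ Finset.Icc 1 n := by simp
  have hmem : ∀ {j : ℕ} {s : Finset ℕ}, s ∈ (Finset.Icc 1 n).powersetCard j → n + 1 ∉ s :=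
    fun hs h => hn ((Finset.mem_powersetCard.1 hs).1 h)
  rw [gaussPoly, ← Finset.insert_Icc_right_eq_Icc_add_one (by omega),
    Finset.powersetCard_succ_insert hn, Finset.sum_union, Finset.sum_image]
  · rw [gaussPoly, gaussPoly, Finset.mul_sum]
    congr 1
    refine Finset.sum_congr rfl fun s hs => ?_
    obtain ⟨hsub, hcard⟩ := Finset.mem_powersetCard.1 hs
    have hle := card_mul_card_add_one_div_two_le_sum s fun h => by simpa using hsub h
    rw [hcard] at hle
    rw [Finset.sum_insert (hmem hs), ← pow_add]
    have hexp : (k + 1) * (k + 1 + 1) = k * (k + 1) + 2 * (k + 1) := by ring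
    congr 1
    omega
  · intro s hs t ht hst
    rw [← Finset.erase_insert (hmem hs), hst, Finset.erase_insert (hmem ht)]
  · refine Finset.disjoint_left.2 fun s hs hs' => hmem hs ?_
    obtain ⟨t, -, rfl⟩ := Finset.mem_image.1 hs'
    exact Finset.mem_insert_self _ _

lemma isMonicOfDegree_gaussPoly {n k : ℕ} (h : k ≤ n) :
    (gaussPoly n k).IsMonicOfDegree (k * (n - k)) := by
  induction n generalizing k with
  | zero =>
    obtain rfl := Nat.le_zero.1 h
    simp [gaussPoly_zero_right, Polynomial.isMonicOfDegree_zero_iff]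
  | succ n ih =>
    cases k with
    | zero => simp [gaussPoly_zero_right, Polynomial.isMonicOfDegree_zero_iff]
    | succ k =>
      have hk : k ≤ n := by omega
      have hmul := (Polynomial.isMonicOfDegree_X_pow ℤ (n - k)).mul (ih hk)
      rw [gaussPoly_succ_succ hk, Nat.add_sub_add_right, Nat.succ_mul, Nat.add_comm (k * _)]
      rcases hk.eq_or_lt with rfl | hlt
      · rwa [gaussPoly_eq_zero (Nat.lt_succ_self _), zero_add]
      · refine hmul.add_left ?_
        rw [(ih hlt).natDegree_eq]
        obtain ⟨d, rfl⟩ := Nat.exists_eq_add_of_lt hlt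
        rw [show k + d + 1 - (k + 1) = d by omega, show k + d + 1 - k = d + 1 by omega]
        nlinarith

lemma coeff_gaussPoly_of_le {n k d : ℕ} (h : k ≤ n) (hd : k * (n - k) ≤ d) :
    (gaussPoly n k).coeff d = if k * (n - k) = d then 1 else 0 := by
  rw [(isMonicOfDegree_gaussPoly h).coeff_eq (Polynomial.isMonicOfDegree_X_pow ℤ _) hd,
    Polynomial.coeff_X_pow]
  simp only [eq_comm]

lemma aNPK_eq_aFormula (p n k : ℕ) : aNPK p n k = aFormula p n k := by
  rw [aNPK]
  split_ifs with h
  · rcases h with rfl | rfl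
    · simp [aFormula]
    · have hself : (Finset.Icc 1 k).powersetCard k = {Finset.Icc 1 k} := by
        simpa using Finset.powersetCard_self (Finset.Icc 1 k)
      have hsum : ∑ i ∈ Finset.Icc 1 k, i = k * (k + 1) / 2 := by
        have hins : Finset.range (k + 1) = insert 0 (Finset.Icc 1 k) := by
          ext x
          simp only [Finset.mem_range, Finset.mem_insert, Finset.mem_Icc]
          omega
        have hgauss := Finset.sum_range_id (k + 1)
        rwa [hins, Finset.sum_insert (by simp), zero_add, Nat.add_sub_cancel, Nat.mul_comm] at hgauss
      rw [aFormula, hself, Finset.sum_singleton, hsum, Nat.sub_self, pow_zero]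
  · rfl

lemma eval_gaussPoly (p n k : ℕ) : (gaussPoly n k).eval (p : ℤ) = aNPK p n k := by
  simp [aNPK_eq_aFormula, gaussPoly, aFormula, Polynomial.eval_finsetSum]

lemma mul_sub_le_sq_div_four {n k : ℕ} (h : k ≤ n) : k * (n - k) ≤ n ^ 2 / 4 := by
  obtain ⟨d, rfl⟩ := Nat.exists_eq_add_of_le h
  rw [Nat.add_sub_cancel_left, Nat.le_div_iff_mul_le (by norm_num)]
  zify
  nlinarith [sq_nonneg ((k : ℤ) - d)]

lemma card_filter_mul_sub_eq_sq_div_four (n : ℕ) :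
    ((Finset.range (n + 1)).filter fun k => k * (n - k) = n ^ 2 / 4).card =
      if Even n then 1 else 2 := by
  rcases Nat.even_or_odd' n with ⟨m, rfl | rfl⟩
  · have hdiv : (2 * m) ^ 2 / 4 = m * m := by
      rw [show (2 * m) ^ 2 = 4 * (m * m) by ring, Nat.mul_div_cancel_left _ (by norm_num)]
    rw [if_pos (even_two_mul m), Finset.card_eq_one]
    refine ⟨m, Finset.ext fun k => ?_⟩
    rw [Finset.mem_filter, Finset.mem_range, Finset.mem_singleton, hdiv]
    constructor
    · rintro ⟨hk, heq⟩
      zify [show k ≤ 2 * m by omega] at heq ⊢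
      have hsq : ((k : ℤ) - m) ^ 2 = 0 := by linarith
      exact sub_eq_zero.1 (pow_eq_zero_iff two_ne_zero |>.1 hsq)
    · rintro rfl
      exact ⟨by omega, by rw [show 2 * k - k = k by omega]⟩
  · have hdiv : (2 * m + 1) ^ 2 / 4 = m * (m + 1) := by
      rw [show (2 * m + 1) ^ 2 = 1 + 4 * (m * (m + 1)) by ring,
        Nat.add_mul_div_left _ _ (by norm_num)]
      simp
    rw [if_neg (by simp), Finset.card_eq_two]
    refine ⟨m, m + 1, by simp, Finset.ext fun k => ?_⟩
    rw [Finset.mem_filter, Finset.mem_range, Finset.mem_insert, Finset.mem_singleton, hdiv]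
    constructor
    · rintro ⟨hk, heq⟩
      zify [show k ≤ 2 * m + 1 by omega] at heq ⊢
      have hmul : ((k : ℤ) - m) * (k - (m + 1)) = 0 := by linarith
      exact (mul_eq_zero.1 hmul).imp sub_eq_zero.1 sub_eq_zero.1
    · rintro (rfl | rfl)
      · exact ⟨by omega, by rw [show 2 * k + 1 - k = k + 1 by omega]⟩
      · exact ⟨by omega, by rw [show 2 * m + 1 - (m + 1) = m by omega, Nat.mul_comm]⟩

/-- There is an integer polynomial `f_n` of degree `⌊n²/4⌋` with leading coefficient `1`
for even `n` and `2` for odd `n`, such that `a_{n,p} = f_n(p)` for every prime `p`. -/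
theorem aNP_polynomial (n : ℕ) (hn : 1 ≤ n) :
    ∃ f : Polynomial ℤ,
      (∀ p : ℕ, p.Prime → f.eval (p : ℤ) = aNP p n) ∧
      f.natDegree = n ^ 2 / 4 ∧
      f.leadingCoeff = (if Even n then 1 else 2) := by
  have hcoeff : (∑ k ∈ Finset.range (n + 1), gaussPoly n k).coeff (n ^ 2 / 4) =
      if Even n then 1 else 2 := by
    have hcount := card_filter_mul_sub_eq_sq_div_four n
    rw [Polynomial.finsetSum_coeff, Finset.sum_congr rfl fun k hk =>
      coeff_gaussPoly_of_le (Finset.mem_range_succ_iff.1 hk)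
        (mul_sub_le_sq_div_four (Finset.mem_range_succ_iff.1 hk)), Finset.sum_boole, hcount]
    split_ifs <;> rfl
  have hdeg : (∑ k ∈ Finset.range (n + 1), gaussPoly n k).natDegree = n ^ 2 / 4 := by
    refine Polynomial.natDegree_eq_of_le_of_coeff_ne_zero
      (Polynomial.natDegree_sum_le_of_forall_le _ _ fun k hk => ?_) ?_
    · have hk' := Finset.mem_range_succ_iff.1 hk
      exact (isMonicOfDegree_gaussPoly hk').natDegree_eq.trans_le (mul_sub_le_sq_div_four hk')
    · rw [hcoeff]
      split_ifs <;> norm_num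
  refine ⟨∑ k ∈ Finset.range (n + 1), gaussPoly n k, fun p _ => ?_, hdeg, ?_⟩
  · simp [aNP, Polynomial.eval_finsetSum, eval_gaussPoly]
  · rw [Polynomial.leadingCoeff, hdeg, hcoeff]
end
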